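/- Suppose F ∈ 𝓔^m is essentially smooth. Let 𝓛 ⊆ S^m be an affine subspace and S_n ∈ S^m, and define g_n(L) := −F*(L) + ⟨L, S_n⟩. Then the maximum of g_n over 𝓛 ∩ 𝕃^m_+ is attained if and only if the orthogonal projection (S_n)_𝓛 of S_n onto 𝓛 belongs to (S^m_+)_𝓛, the image of S^m_+ under orthogonal projection onto 𝓛. -/

import Mathlib

open Matrix Filter Topology

namespace Entropic

abbrev Mat (m : ℕ) := Matrix (Fin m) (Fin m) ℝ

variable {m : ℕ}

/-- The trace inner product `⟨A,B⟩ = tr(AB)` on matrices. -/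
noncomputable def ip (A B : Mat m) : ℝ := (A * B).trace

/-- The Frobenius norm `‖A‖_F = √tr(AAᵀ)`. -/
noncomputable def fnorm (A : Mat m) : ℝ := Real.sqrt (ip A Aᵀ)

/-- The class `𝓔^m`: proper convex lower semicontinuous `F : S^m → ℝ ∪ {+∞}` with
`S^m_+ ⊆ dom F ⊆ cl(S^m_+)` which is strictly convex and continuously differentiable on
`S^m_+`; the (trace-inner-product) gradient on `S^m_+` is bundled as `grad`. -/
structure EClass (m : ℕ) where
  F : Mat m → EReal
  grad : Mat m → Mat m
  F_ne_bot : ∀ A : Mat m, F A ≠ ⊥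
  convex : ∀ x y : Mat m, x.IsHermitian → y.IsHermitian → ∀ a b : ℝ,
    0 ≤ a → 0 ≤ b → a + b = 1 →
    F (a • x + b • y) ≤ (a : EReal) * F x + (b : EReal) * F y
  lsc : LowerSemicontinuousOn F {A : Mat m | A.IsHermitian}
  posDef_mem_dom : ∀ A : Mat m, A.PosDef → F A ≠ ⊤
  dom_subset_psd : ∀ A : Mat m, F A ≠ ⊤ → A.PosSemidef
  strictConvex : ∀ x y : Mat m, x.PosDef → y.PosDef → x ≠ y → ∀ a b : ℝ,
    0 < a → 0 < b → a + b = 1 →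
    F (a • x + b • y) < (a : EReal) * F x + (b : EReal) * F y
  grad_isHermitian : ∀ P : Mat m, P.PosDef → (grad P).IsHermitian
  hasGradAt : ∀ P : Mat m, P.PosDef → ∀ H : Mat m, H.IsHermitian →
    HasDerivAt (fun t : ℝ => (F (P + t • H)).toReal) (ip (grad P) H) 0
  grad_continuousOn : ContinuousOn grad {A : Mat m | A.PosDef}

/-- `𝕃^m_+ = ∇F(S^m_+)`. -/
def Lplus (E : EClass m) : Set (Mat m) := E.grad '' {A : Mat m | A.PosDef}

/-- The Fenchel conjugate `F*(L) = sup_{Σ ∈ S^m} (⟨Σ,L⟩ − F(Σ))`. -/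
noncomputable def conj (E : EClass m) (L : Mat m) : EReal :=
  ⨆ S : {A : Mat m // A.IsHermitian}, ((ip (S : Mat m) L : EReal) - E.F (S : Mat m))

/-- `g_n(L) = −F*(L) + ⟨L, S_n⟩`. -/
noncomputable def gn (E : EClass m) (Sn L : Mat m) : EReal :=
  -(conj E L) + (ip L Sn : EReal)

/-- A set `U ⊆ S^m` is (relatively) open in `S^m`. -/
def RelOpen (U : Set (Mat m)) : Prop :=
  U ⊆ {A : Mat m | A.IsHermitian} ∧
    ∀ L ∈ U, ∃ ε > 0, ∀ M : Mat m, M.IsHermitian → fnorm (M - L) < ε → M ∈ U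

/-- The affine subspace `A₀ + V` of `S^m`. -/
def affSet (A0 : Mat m) (V : Submodule ℝ (Mat m)) : Set (Mat m) :=
  {L : Mat m | L - A0 ∈ V}

/-- The orthogonal complement in `S^m` (w.r.t. the trace inner product) of the linear
subspace `V`. -/
def perp (V : Submodule ℝ (Mat m)) : Set (Mat m) :=
  {W : Mat m | W.IsHermitian ∧ ∀ U ∈ V, ip W U = 0}


/-- `F ∈ 𝓔^m` is essentially smooth: the gradient blows up along every sequence in
`S^m_+ = int(dom F)` converging to a boundary point of `dom F` (i.e. a singular positive
semidefinite matrix). -/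
def EssSmooth {m : ℕ} (E : EClass m) : Prop :=
  ∀ (P : ℕ → Mat m) (B : Mat m), (∀ k, (P k).PosDef) → Tendsto P atTop (𝓝 B) →
    B.PosSemidef → ¬ B.PosDef → Tendsto (fun k => fnorm (E.grad (P k))) atTop atTop

/-- `X` is the orthogonal projection (w.r.t. the trace inner product) of `S` onto the
affine subspace `A₀ + V`. -/
def IsProjOn {m : ℕ} (A0 : Mat m) (V : Submodule ℝ (Mat m)) (S X : Mat m) : Prop :=
  X ∈ affSet A0 V ∧ ∀ U ∈ V, ip (S - X) U = 0

section Auxiliary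

open scoped Matrix.Norms.Elementwise

section TraceInnerProduct

/-- The trace inner product as a bilinear form on all matrices. -/
noncomputable def ipForm (m : ℕ) : LinearMap.BilinForm ℝ (Mat m) :=
  LinearMap.mk₂ ℝ ip (by intros; simp [ip, add_mul]) (by intros; simp [ip])
    (by intros; simp [ip, mul_add]) (by intros; simp [ip])

@[simp] lemma ipForm_apply (A B : Mat m) : ipForm m A B = ip A B := rfl

lemma ip_comm (A B : Mat m) : ip A B = ip B A := trace_mul_comm A B

lemma ip_add_left (A B C : Mat m) : ip (A + B) C = ip A C + ip B C := by
  simp [ip, add_mul]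

lemma ip_add_right (A B C : Mat m) : ip A (B + C) = ip A B + ip A C := by
  simp [ip, mul_add]

lemma ip_sub_left (A B C : Mat m) : ip (A - B) C = ip A C - ip B C := by
  simp [ip, sub_mul]

lemma ip_sub_right (A B C : Mat m) : ip A (B - C) = ip A B - ip A C := by
  simp [ip, mul_sub]

lemma ip_smul_left (a : ℝ) (A B : Mat m) : ip (a • A) B = a * ip A B := by
  simp [ip]

lemma ip_smul_right (a : ℝ) (A B : Mat m) : ip A (a • B) = a * ip A B := by
  simp [ip]

lemma ip_transpose (A B : Mat m) : ip Aᵀ Bᵀ = ip A B := by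
  rw [ip, ← transpose_mul, trace_transpose, trace_mul_comm, ip]

lemma continuous_ip : Continuous fun p : Mat m × Mat m => ip p.1 p.2 :=
  (continuous_fst.matrix_mul continuous_snd).matrix_trace

lemma continuousOn_ip {X : Type*} [TopologicalSpace X] {s : Set X} {f g : X → Mat m}
    (hf : ContinuousOn f s) (hg : ContinuousOn g s) : ContinuousOn (fun x => ip (f x) (g x)) s := by
  rw [continuousOn_iff_continuous_domRestrict] at hf hg ⊢
  exact (hf.matrix_mul hg).matrix_trace

lemma ip_transpose_self_nonneg (A : Mat m) : 0 ≤ ip A Aᵀ := by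
  simp only [ip, trace, diag, mul_apply, transpose_apply]
  exact Finset.sum_nonneg fun i _ => Finset.sum_nonneg fun j _ => mul_self_nonneg _

lemma eq_zero_of_ip_transpose_self {A : Mat m} (h : ip A Aᵀ = 0) : A = 0 := by
  rw [ip, ← conjTranspose_eq_transpose_of_trivial] at h
  exact trace_mul_conjTranspose_self_eq_zero_iff.mp h

lemma transpose_eq_self {A : Mat m} (h : A.IsHermitian) : Aᵀ = A := by
  rw [← conjTranspose_eq_transpose_of_trivial]; exact h

lemma isHermitian_smul {A : Mat m} (h : A.IsHermitian) (a : ℝ) : (a • A).IsHermitian := by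
  rw [IsHermitian, conjTranspose_smul, h.eq]; simp

lemma eq_zero_of_ip_self {A : Mat m} (hA : A.IsHermitian) (h : ip A A = 0) : A = 0 :=
  eq_zero_of_ip_transpose_self (by rwa [transpose_eq_self hA])

lemma ip_self_eq_fnorm_sq {A : Mat m} (hA : A.IsHermitian) : ip A A = fnorm A ^ 2 := by
  rw [fnorm, Real.sq_sqrt (ip_transpose_self_nonneg A), transpose_eq_self hA]

lemma norm_le_fnorm (A : Mat m) : ‖A‖ ≤ fnorm A := by
  refine (norm_le_iff (Real.sqrt_nonneg _)).mpr fun i j => ?_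
  rw [Real.norm_eq_abs]
  refine Real.abs_le_sqrt ?_
  simp only [ip, trace, diag, mul_apply, transpose_apply]
  calc A i j ^ 2 = A i j * A i j := sq _
    _ ≤ ∑ k, A i k * A i k :=
      Finset.single_le_sum (f := fun k => A i k * A i k) (fun k _ => mul_self_nonneg _)
        (Finset.mem_univ j)
    _ ≤ _ := Finset.single_le_sum (f := fun l => ∑ k, A l k * A l k)
        (fun l _ => Finset.sum_nonneg fun k _ => mul_self_nonneg _) (Finset.mem_univ i)

lemma exists_abs_ip_le (U : Mat m) : ∃ C > 0, ∀ X : Mat m, |ip U X| ≤ C * ‖X‖ := by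
  refine ⟨(∑ i, ∑ j, |U i j|) + 1, by positivity, fun X => ?_⟩
  calc |ip U X| ≤ ∑ i, ∑ j, |U i j| * ‖X‖ := by
        simp only [ip, trace, diag, mul_apply]
        refine (Finset.abs_sum_le_sum_abs _ _).trans (Finset.sum_le_sum fun i _ => ?_)
        refine (Finset.abs_sum_le_sum_abs _ _).trans (Finset.sum_le_sum fun j _ => ?_)
        rw [abs_mul]
        gcongr
        exact norm_entry_le_entrywise_sup_norm X
    _ = (∑ i, ∑ j, |U i j|) * ‖X‖ := by simp only [Finset.sum_mul]
    _ ≤ ((∑ i, ∑ j, |U i j|) + 1) * ‖X‖ := by gcongr; linarith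

lemma isRefl_ipForm : (ipForm m).IsRefl := fun A B h => by
  rw [ipForm_apply, ip_comm]; exact h

lemma nondegenerate_ipForm : (ipForm m).Nondegenerate :=
  ⟨fun A h => eq_zero_of_ip_transpose_self (h Aᵀ),
    fun A h => eq_zero_of_ip_transpose_self (by rw [ip_comm]; exact h Aᵀ)⟩

/-- Within the symmetric matrices, the double orthogonal complement of `V` is `V`. -/
lemma mem_of_forall_ip_perp {V : Submodule ℝ (Mat m)} (hV : ∀ A ∈ V, A.IsHermitian) {D : Mat m}
    (hD : D.IsHermitian) (h : ∀ W ∈ perp V, ip D W = 0) : D ∈ V := by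
  rw [← LinearMap.BilinForm.orthogonal_orthogonal nondegenerate_ipForm isRefl_ipForm V,
    LinearMap.BilinForm.mem_orthogonal_iff]
  intro W hW
  rw [LinearMap.BilinForm.mem_orthogonal_iff] at hW
  have hWV : ∀ U ∈ V, ip U W = 0 := hW
  have hsymm : ∀ U : Mat m, U.IsHermitian → ip U (W + Wᵀ) = 2 * ip U W := fun U hU => by
    have := ip_transpose U W
    rw [transpose_eq_self hU] at this
    rw [ip_add_right, this]; ring
  have hmem : W + Wᵀ ∈ perp V := by
    refine ⟨?_, fun U hU => ?_⟩
    · rw [← conjTranspose_eq_transpose_of_trivial]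
      exact isHermitian_add_transpose_self W
    · rw [ip_comm, hsymm U (hV U hU), hWV U hU, mul_zero]
  have h2 := h _ hmem
  rw [hsymm D hD] at h2
  change ip W D = 0
  rw [ip_comm]; linarith

lemma exists_isProjOn {V : Submodule ℝ (Mat m)} (hV : ∀ A ∈ V, A.IsHermitian) (A0 S : Mat m) :
    ∃ X, IsProjOn A0 V S X := by
  have hcompl : IsCompl V ((ipForm m).orthogonal V) := by
    refine LinearMap.BilinForm.isCompl_orthogonal_of_restrict_nondegenerate isRefl_ipForm ?_
    have key : ∀ x : V, ip (x : Mat m) x = 0 → x = 0 := fun x hx =>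
      Subtype.ext (eq_zero_of_ip_self (hV x x.2) hx)
    exact ⟨fun x hx => key x (hx x), fun x hx => key x (hx x)⟩
  obtain ⟨v, hv, w, hw, hvw⟩ := Submodule.mem_sup.mp
    (hcompl.sup_eq_top ▸ Submodule.mem_top : S - A0 ∈ V ⊔ (ipForm m).orthogonal V)
  refine ⟨A0 + v, by simpa [affSet] using hv, fun U hU => ?_⟩
  have : S - (A0 + v) = w := by rw [← sub_sub, ← hvw]; abel
  rw [this, ip_comm]
  exact hw U hU

end TraceInnerProduct

section PositiveDefinite

lemma isClosed_isHermitian : IsClosed {A : Mat m | A.IsHermitian} :=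
  isClosed_eq continuous_id.matrix_conjTranspose continuous_id

lemma exists_closedBall_posDef {P : Mat m} (hP : P.PosDef) :
    ∃ r > 0, ∀ Q : Mat m, Q.IsHermitian → ‖Q - P‖ ≤ r → Q.PosDef := by
  have hev : ∀ᶠ Q : Mat m in 𝓝 P, ∀ x ∈ Metric.sphere (0 : Fin m → ℝ) 1,
      0 < x ⬝ᵥ (Q *ᵥ x) := by
    refine (isCompact_sphere _ _).eventually_forall_of_forall_eventually fun x hx => ?_
    have hcont : Continuous fun z : Mat m × (Fin m → ℝ) => z.2 ⬝ᵥ (z.1 *ᵥ z.2) :=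
      continuous_snd.dotProduct (continuous_fst.matrix_mulVec continuous_snd)
    refine hcont.continuousAt.eventually (lt_mem_nhds ?_)
    exact hP.dotProduct_mulVec_pos (ne_zero_of_mem_unit_sphere ⟨x, hx⟩)
  obtain ⟨r, hr, hball⟩ := Metric.nhds_basis_closedBall.eventually_iff.mp hev
  refine ⟨r, hr, fun Q hQ hQP => PosDef.of_dotProduct_mulVec_pos hQ fun x hx => ?_⟩
  have hx' : 0 < ‖x‖ := norm_pos_iff.mpr hx
  have h := hball (by rwa [Metric.mem_closedBall, dist_eq_norm]) (‖x‖⁻¹ • x)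
    (by simp [norm_smul, hx'.ne'])
  rw [mulVec_smul, smul_dotProduct, dotProduct_smul, smul_eq_mul, smul_eq_mul] at h
  have hi : 0 < ‖x‖⁻¹ := inv_pos.mpr hx'
  exact pos_of_mul_pos_right (pos_of_mul_pos_right h hi.le) hi.le

lemma isCompact_isHermitian_inter_closedBall (P : Mat m) (r : ℝ) :
    IsCompact ({A : Mat m | A.IsHermitian} ∩ Metric.closedBall P r) :=
  (isCompact_closedBall P r).inter_left isClosed_isHermitian

lemma eventually_norm_add_smul_sub_lt {A P : Mat m} (H : Mat m) {r : ℝ} (h : ‖A - P‖ < r) :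
    ∀ᶠ s : ℝ in 𝓝 0, ‖A + s • H - P‖ < r := by
  have hcont : Continuous fun s : ℝ => ‖A - P‖ + |s| * ‖H‖ := by fun_prop
  have hev : ∀ᶠ s : ℝ in 𝓝 0, ‖A - P‖ + |s| * ‖H‖ < r :=
    (hcont.tendsto 0).eventually_lt_const (by simpa using h)
  filter_upwards [hev] with s hs
  refine lt_of_le_of_lt ?_ hs
  rw [add_sub_right_comm, ← Real.norm_eq_abs, ← norm_smul]
  exact norm_add_le _ _

end PositiveDefinite

namespace EClass

variable (E : EClass m)

/-- The real-valued restriction of `F` to its effective domain. -/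
noncomputable def f (A : Mat m) : ℝ := (E.F A).toReal

variable {E}

lemma coe_f {A : Mat m} (hA : E.F A ≠ ⊤) : (E.f A : EReal) = E.F A :=
  EReal.coe_toReal hA (E.F_ne_bot A)

lemma isHermitian_of_ne_top {A : Mat m} (hA : E.F A ≠ ⊤) : A.IsHermitian :=
  (E.dom_subset_psd A hA).isHermitian

lemma f_convex {x y : Mat m} (hx : E.F x ≠ ⊤) (hy : E.F y ≠ ⊤) {a b : ℝ} (ha : 0 ≤ a)
    (hb : 0 ≤ b) (hab : a + b = 1) :
    E.F (a • x + b • y) ≠ ⊤ ∧ E.f (a • x + b • y) ≤ a * E.f x + b * E.f y := by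
  have h := E.convex x y (isHermitian_of_ne_top hx) (isHermitian_of_ne_top hy) a b ha hb hab
  rw [← coe_f hx, ← coe_f hy] at h
  have hne : E.F (a • x + b • y) ≠ ⊤ := by
    refine ne_top_of_le_ne_top ?_ h
    exact_mod_cast EReal.coe_ne_top (a * E.f x + b * E.f y)
  refine ⟨hne, ?_⟩
  rw [← coe_f hne] at h
  exact_mod_cast h

lemma f_segment_le {P Q : Mat m} (hP : E.F P ≠ ⊤) (hQ : E.F Q ≠ ⊤) {t : ℝ} (h0 : 0 ≤ t)
    (h1 : t ≤ 1) :
    E.F (P + t • (Q - P)) ≠ ⊤ ∧ E.f (P + t • (Q - P)) ≤ E.f P + t * (E.f Q - E.f P) := by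
  have h := f_convex hP hQ (sub_nonneg.mpr h1) h0 (sub_add_cancel 1 t)
  have e : P + t • (Q - P) = (1 - t) • P + t • Q := by module
  rw [e]
  exact ⟨h.1, h.2.trans_eq (by ring)⟩

lemma ip_grad_le {P Q : Mat m} (hP : P.PosDef) (hQ : E.F Q ≠ ⊤) :
    ip (E.grad P) (Q - P) ≤ E.f Q - E.f P := by
  have hd := E.hasGradAt P hP (Q - P) ((isHermitian_of_ne_top hQ).sub hP.isHermitian)
  have ht := hd.tendsto_slope_zero_right
  refine le_of_tendsto ht ?_
  filter_upwards [Ioc_mem_nhdsGT (zero_lt_one' ℝ)] with t ht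
  have h := (f_segment_le (E.posDef_mem_dom P hP) hQ ht.1.le ht.2).2
  have hi : 0 < t⁻¹ := inv_pos.mpr ht.1
  simp only [zero_add, zero_smul, add_zero, smul_eq_mul]
  change t⁻¹ * (E.f (P + t • (Q - P)) - E.f P) ≤ _
  calc _ ≤ t⁻¹ * (t * (E.f Q - E.f P)) := by gcongr; linarith
    _ = _ := by field_simp [ht.1.ne']

lemma ip_grad_lt {P Q : Mat m} (hP : P.PosDef) (hQ : Q.PosDef) (hPQ : P ≠ Q) :
    ip (E.grad P) (Q - P) < E.f Q - E.f P := by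
  have hFP := E.posDef_mem_dom P hP
  have hFQ := E.posDef_mem_dom Q hQ
  have h := E.strictConvex P Q hP hQ hPQ (1 / 2) (1 / 2) (by norm_num) (by norm_num) (by norm_num)
  have hM := (f_convex hFP hFQ (a := 1 / 2) (b := 1 / 2) (by norm_num) (by norm_num)
    (by norm_num)).1
  rw [← coe_f hFP, ← coe_f hFQ, ← coe_f hM] at h
  have h' : E.f ((1 / 2 : ℝ) • P + (1 / 2 : ℝ) • Q) < 1 / 2 * E.f P + 1 / 2 * E.f Q := by
    exact_mod_cast h
  have hg := ip_grad_le hP hM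
  have e : (1 / 2 : ℝ) • P + (1 / 2 : ℝ) • Q - P = (1 / 2 : ℝ) • (Q - P) := by module
  rw [e, ip_smul_right] at hg
  linarith

lemma exists_min_tilted {K : Set (Mat m)} (hK : IsCompact K) (hKH : ∀ A ∈ K, A.IsHermitian)
    {P : Mat m} (hPK : P ∈ K) (hP : E.F P ≠ ⊤) (L : Mat m) :
    ∃ A ∈ K, E.F A ≠ ⊤ ∧ ∀ B ∈ K, E.F B ≠ ⊤ → E.f A - ip L A ≤ E.f B - ip L B := by
  have hlsc : LowerSemicontinuousOn (fun A => E.F A + ((-ip L A : ℝ) : EReal)) K := by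
    refine (E.lsc.mono hKH).add' ((Continuous.lowerSemicontinuous ?_).lowerSemicontinuousOn _)
      fun A _ => EReal.continuousAt_add (Or.inr (EReal.coe_ne_bot _))
        (Or.inr (EReal.coe_ne_top _))
    exact continuous_coe_real_ereal.comp
      (continuous_ip.comp (continuous_const.prodMk continuous_id)).neg
  obtain ⟨A, hAK, hmin⟩ := hlsc.exists_isMinOn ⟨P, hPK⟩ hK
  have hle : ∀ B ∈ K, E.F A + ((-ip L A : ℝ) : EReal) ≤ E.F B + ((-ip L B : ℝ) : EReal) :=
    fun B hB => hmin hB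
  have hA : E.F A ≠ ⊤ := fun htop => by
    have h := hle P hPK
    rw [htop, EReal.top_add_coe, top_le_iff, ← coe_f hP, ← EReal.coe_add] at h
    exact EReal.coe_ne_top _ h
  refine ⟨A, hAK, hA, fun B hB hFB => ?_⟩
  have h := hle B hB
  rw [← coe_f hA, ← coe_f hFB, ← EReal.coe_add, ← EReal.coe_add, EReal.coe_le_coe_iff] at h
  linarith

/-- The Bregman divergence from `P` grows at least linearly away from `P`. -/
lemma exists_linear_growth {P : Mat m} (hP : P.PosDef) {r : ℝ} (hr : 0 < r)
    (hball : ∀ Q : Mat m, Q.IsHermitian → ‖Q - P‖ ≤ r → Q.PosDef) :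
    ∃ δ > 0, ∀ Q : Mat m, E.F Q ≠ ⊤ → r ≤ ‖Q - P‖ →
      δ * ‖Q - P‖ ≤ E.f Q - E.f P - ip (E.grad P) (Q - P) := by
  have hFP := E.posDef_mem_dom P hP
  set K : Set (Mat m) := {A : Mat m | A.IsHermitian} ∩ Metric.sphere P r
  have hK : IsCompact K := (isCompact_sphere P r).inter_left isClosed_isHermitian
  have hKPD : ∀ A ∈ K, A.PosDef := fun A hA => hball A hA.1 (by
    rw [← dist_eq_norm]; exact (Metric.mem_sphere.mp hA.2).le)
  have hscale : ∀ Q : Mat m, E.F Q ≠ ⊤ → r ≤ ‖Q - P‖ → P + (r / ‖Q - P‖) • (Q - P) ∈ K := by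
    intro Q hQ hQr
    refine ⟨hP.isHermitian.add (isHermitian_smul ((isHermitian_of_ne_top hQ).sub
      hP.isHermitian) _), ?_⟩
    have hpos : 0 < ‖Q - P‖ := hr.trans_le hQr
    rw [Metric.mem_sphere, dist_eq_norm, add_sub_cancel_left, norm_smul, Real.norm_eq_abs,
      abs_of_pos (div_pos hr hpos), div_mul_cancel₀ _ hpos.ne']
  by_cases hne : K.Nonempty
  · obtain ⟨A₀, hA₀⟩ := hne
    obtain ⟨A, hAK, hFA, hmin⟩ := exists_min_tilted hK (fun A hA => hA.1) hA₀
      (E.posDef_mem_dom _ (hKPD _ hA₀)) (E.grad P)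
    have hPA : P ≠ A := by
      rintro rfl
      exact Metric.ne_of_mem_sphere hAK.2 hr.ne' rfl
    have hgap := ip_grad_lt (E := E) hP (hKPD A hAK) hPA
    refine ⟨(E.f A - E.f P - ip (E.grad P) (A - P)) / r, div_pos (by linarith) hr,
      fun Q hQ hQr => ?_⟩
    have hpos : 0 < ‖Q - P‖ := hr.trans_le hQr
    have hseg := f_segment_le hFP hQ (div_pos hr hpos).le ((div_le_one hpos).mpr hQr)
    have hZ := hmin _ (hscale Q hQ hQr) hseg.1
    rw [ip_add_right, ip_smul_right] at hZ
    rw [div_mul_eq_mul_div, div_le_iff₀ hr, ← le_div_iff₀ hpos, mul_div_assoc, mul_comm]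
    rw [ip_sub_right] at hgap ⊢
    linarith [hseg.2]
  · exact ⟨1, one_pos, fun Q hQ hQr => (hne ⟨_, hscale Q hQ hQr⟩).elim⟩

lemma ip_grad_sub_eq_zero {A L H : Mat m} (hA : A.PosDef) (hH : H.IsHermitian)
    (hmin : ∀ᶠ t : ℝ in 𝓝 0, E.f A - ip L A ≤ E.f (A + t • H) - ip L (A + t • H)) :
    ip (E.grad A - L) H = 0 := by
  have hd : HasDerivAt (fun t : ℝ => E.f (A + t • H) - ip L (A + t • H))
      (ip (E.grad A) H - ip L H) 0 := by
    refine (E.hasGradAt A hA H hH).sub ?_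
    simp only [ip_add_right, ip_smul_right]
    simpa using ((hasDerivAt_id (0 : ℝ)).mul_const (ip L H)).const_add (ip L A)
  have hlm : IsLocalMin (fun t : ℝ => E.f (A + t • H) - ip L (A + t • H)) 0 := by
    filter_upwards [hmin] with t ht
    simpa using ht
  rw [ip_sub_left]
  exact hlm.hasDerivAt_eq_zero hd

/-- The image of the gradient contains a neighbourhood of each of its points, with preimages
close to the base point. -/
lemma exists_grad_eq_add_smul {P U : Mat m} (hP : P.PosDef) (hU : U.IsHermitian) {r : ℝ}
    (hr : 0 < r) :
    ∃ t : ℝ, 0 < t ∧ ∃ Q : Mat m, Q.PosDef ∧ ‖Q - P‖ ≤ r ∧ E.grad Q = E.grad P + t • U := by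
  obtain ⟨r₀, hr₀, hball₀⟩ := exists_closedBall_posDef hP
  set ρ := min r r₀
  have hρ : 0 < ρ := lt_min hr hr₀
  have hball : ∀ Q : Mat m, Q.IsHermitian → ‖Q - P‖ ≤ ρ → Q.PosDef := fun Q hQ h =>
    hball₀ Q hQ (h.trans (min_le_right _ _))
  obtain ⟨δ, hδ, hgrowth⟩ := exists_linear_growth (E := E) hP hρ hball
  obtain ⟨C, hC, hCU⟩ := exists_abs_ip_le U
  set t := δ / (2 * C)
  have ht : 0 < t := by positivity
  have hFP := E.posDef_mem_dom P hP
  obtain ⟨Q, hQK, hFQ, hmin⟩ := exists_min_tilted (isCompact_isHermitian_inter_closedBall P ρ)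
    (fun A hA => hA.1) ⟨hP.isHermitian, Metric.mem_closedBall_self hρ.le⟩ hFP
    (E.grad P + t • U)
  have hQρ : ‖Q - P‖ ≤ ρ := by rw [← dist_eq_norm]; exact hQK.2
  have hQ : Q.PosDef := hball Q hQK.1 hQρ
  have hQlt : ‖Q - P‖ < ρ := by
    by_contra hcon
    have h1 := hgrowth Q hFQ (not_lt.mp hcon)
    have h2 := hmin P ⟨hP.isHermitian, Metric.mem_closedBall_self hρ.le⟩ hFP
    have h3 : t * ip U (Q - P) ≤ t * (C * ‖Q - P‖) :=
      mul_le_mul_of_nonneg_left ((le_abs_self _).trans (hCU _)) ht.le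
    have h4 : t * (C * ‖Q - P‖) = δ * ‖Q - P‖ / 2 := by simp only [t]; field_simp
    have h5 : 0 < δ * ‖Q - P‖ := mul_pos hδ (hρ.trans_le (not_lt.mp hcon))
    simp only [ip_add_left, ip_smul_left, ip_sub_right] at h1 h2 h3
    linarith
  refine ⟨t, ht, Q, hQ, hQρ.trans (min_le_left _ _), ?_⟩
  have hDH : (E.grad Q - (E.grad P + t • U)).IsHermitian :=
    (E.grad_isHermitian Q hQ).sub ((E.grad_isHermitian P hP).add (isHermitian_smul hU t))
  refine sub_eq_zero.mp (eq_zero_of_ip_self hDH (ip_grad_sub_eq_zero hQ hDH ?_))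
  filter_upwards [eventually_norm_add_smul_sub_lt _ hQlt] with s hs
  have hherm := hQ.isHermitian.add (isHermitian_smul hDH s)
  refine hmin _ ⟨hherm, ?_⟩ (E.posDef_mem_dom _ (hball _ hherm hs.le))
  rw [Metric.mem_closedBall, dist_eq_norm]
  exact hs.le

lemma le_conj {A : Mat m} (hA : E.F A ≠ ⊤) (L : Mat m) :
    ((ip A L - E.f A : ℝ) : EReal) ≤ conj E L := by
  rw [EReal.coe_sub, coe_f hA]
  exact le_iSup (fun S : {A : Mat m // A.IsHermitian} =>
    ((ip (S : Mat m) L : EReal) - E.F (S : Mat m))) ⟨A, isHermitian_of_ne_top hA⟩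

lemma conj_grad {P : Mat m} (hP : P.PosDef) :
    conj E (E.grad P) = ((ip P (E.grad P) - E.f P : ℝ) : EReal) := by
  refine le_antisymm (iSup_le fun S => ?_) (le_conj (E.posDef_mem_dom P hP) _)
  by_cases hS : E.F S = ⊤
  · simp [hS]
  · rw [← coe_f hS, ← EReal.coe_sub, EReal.coe_le_coe_iff]
    have h := ip_grad_le hP hS
    rw [ip_sub_right, ip_comm _ (S : Mat m), ip_comm _ P] at h
    linarith

lemma gn_grad {P : Mat m} (hP : P.PosDef) (Sn : Mat m) :
    gn E Sn (E.grad P) = ((E.f P + ip (E.grad P) (Sn - P) : ℝ) : EReal) := by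
  rw [gn, conj_grad hP, ← EReal.coe_neg, ← EReal.coe_add, ip_sub_right, ip_comm P]
  congr 1
  ring

/-- First-order optimality for the maximization of `gn`. -/
lemma ip_sub_eq_zero_of_isMaxOn {V : Submodule ℝ (Mat m)} (hV : ∀ A ∈ V, A.IsHermitian)
    {A0 Sn P : Mat m} (hP : P.PosDef) (hPV : E.grad P ∈ affSet A0 V)
    (hmax : IsMaxOn (gn E Sn) (affSet A0 V ∩ Lplus E) (E.grad P)) :
    ∀ U ∈ V, ip (Sn - P) U = 0 := by
  have hle : ∀ U ∈ V, ip (Sn - P) U ≤ 0 := by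
    intro U hU
    obtain ⟨C, hC, hCU⟩ := exists_abs_ip_le U
    refine le_of_forall_pos_le_add fun ε hε => ?_
    obtain ⟨t, ht, Q, hQ, hQP, hgrad⟩ :=
      exists_grad_eq_add_smul (E := E) hP (hV U hU) (div_pos hε hC)
    have hmem : E.grad Q ∈ affSet A0 V ∩ Lplus E := by
      refine ⟨?_, Q, hQ, rfl⟩
      have e : E.grad P + t • U - A0 = (E.grad P - A0) + t • U := by abel
      rw [hgrad, affSet, Set.mem_ofPred_eq, e]
      exact V.add_mem hPV (V.smul_mem t hU)
    have h1 : gn E Sn (E.grad Q) ≤ gn E Sn (E.grad P) := hmax hmem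
    rw [gn_grad hQ, gn_grad hP, EReal.coe_le_coe_iff, hgrad, ip_add_left, ip_smul_left] at h1
    have h2 := ip_grad_le hP (E.posDef_mem_dom Q hQ)
    have h3 : t * ip U (Sn - Q) ≤ 0 := by
      simp only [ip_sub_right] at h1 h2 ⊢
      linarith
    have h4 : ip U (Sn - Q) ≤ 0 := nonpos_of_mul_nonpos_right h3 ht
    have h5 : ip U (Q - P) ≤ ε :=
      calc _ ≤ C * ‖Q - P‖ := (le_abs_self _).trans (hCU _)
        _ ≤ C * (ε / C) := by gcongr
        _ = ε := by field_simp
    rw [ip_comm]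
    simp only [ip_sub_right] at h4 h5 ⊢
    linarith
  intro U hU
  have h := hle (-U) (V.neg_mem hU)
  rw [← neg_one_smul ℝ U, ip_smul_right] at h
  linarith [hle U hU]

/-- A symmetric matrix `P` with `P - Sn` orthogonal to `V` and `∇F(P) ∈ A₀ + V` yields a
maximizer of `gn`. -/
lemma isMaxOn_gn {V : Submodule ℝ (Mat m)} {A0 Sn P : Mat m} (hP : P.PosDef)
    (hPV : E.grad P ∈ affSet A0 V) (hPS : ∀ U ∈ V, ip (Sn - P) U = 0) :
    IsMaxOn (gn E Sn) (affSet A0 V ∩ Lplus E) (E.grad P) := by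
  rintro _ ⟨hQV, Q, hQ, rfl⟩
  change gn E Sn (E.grad Q) ≤ gn E Sn (E.grad P)
  rw [gn_grad hQ, gn_grad hP, EReal.coe_le_coe_iff]
  have h1 := ip_grad_le hQ (E.posDef_mem_dom P hP)
  have hmem : E.grad Q - E.grad P ∈ V := by
    have e : E.grad Q - E.grad P = (E.grad Q - A0) - (E.grad P - A0) := by abel
    rw [e]
    exact V.sub_mem hQV hPV
  have h2 := hPS _ hmem
  rw [ip_comm, ip_sub_left] at h2
  simp only [ip_sub_right] at h1 h2 ⊢
  linarith

/-- Linear tilts of `F` by elements of the gradient image attain their minimum on closed sets. -/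
lemma exists_min_tilted_of_isClosed {K : Set (Mat m)} (hK : IsClosed K) {P Q : Mat m}
    (hP : P.PosDef) (hQK : Q ∈ K) (hQ : E.F Q ≠ ⊤) :
    ∃ A ∈ K, E.F A ≠ ⊤ ∧
      ∀ B ∈ K, E.F B ≠ ⊤ → E.f A - ip (E.grad P) A ≤ E.f B - ip (E.grad P) B := by
  obtain ⟨r, hr, hball⟩ := exists_closedBall_posDef hP
  obtain ⟨δ, hδ, hgrowth⟩ := exists_linear_growth (E := E) hP hr hball
  set c := E.f Q - E.f P - ip (E.grad P) (Q - P)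
  set R := max r (max ‖Q - P‖ (c / δ))
  have hQR : ‖Q - P‖ ≤ R := (le_max_left _ _).trans (le_max_right _ _)
  obtain ⟨A, hA, hFA, hmin⟩ := exists_min_tilted
    ((isCompact_isHermitian_inter_closedBall P R).inter_left hK)
    (fun A hA => hA.2.1) ⟨hQK, isHermitian_of_ne_top hQ, by
      rw [Metric.mem_closedBall, dist_eq_norm]; exact hQR⟩ hQ (E.grad P)
  refine ⟨A, hA.1, hFA, fun B hBK hB => ?_⟩
  by_cases hBR : ‖B - P‖ ≤ R
  · exact hmin B ⟨hBK, isHermitian_of_ne_top hB, by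
      rw [Metric.mem_closedBall, dist_eq_norm]; exact hBR⟩ hB
  · have hBR' := not_le.mp hBR
    have h1 := hgrowth B hB ((le_max_left _ _).trans hBR'.le)
    have h2 : c ≤ δ * ‖B - P‖ := by
      rw [mul_comm, ← div_le_iff₀ hδ]
      exact ((le_max_right _ _).trans (le_max_right _ _)).trans hBR'.le
    have h3 := hmin Q ⟨hQK, isHermitian_of_ne_top hQ, by
      rw [Metric.mem_closedBall, dist_eq_norm]; exact hQR⟩ hQ
    simp only [c, ip_sub_right] at h1 h2
    linarith

lemma exists_f_le_on_ball {P : Mat m} (hP : P.PosDef) :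
    ∃ ρ : ℝ, 0 < ρ ∧ ∃ M : ℝ, ∀ Q : Mat m, Q.IsHermitian →
      ‖Q - P‖ ≤ ρ → E.F Q ≠ ⊤ ∧ E.f Q ≤ M := by
  obtain ⟨ρ, hρ, hball⟩ := exists_closedBall_posDef hP
  have hsub : ∀ Q ∈ {A : Mat m | A.IsHermitian} ∩ Metric.closedBall P ρ, Q.PosDef :=
    fun Q hQ => by
      refine hball Q hQ.1 ?_
      rw [← dist_eq_norm]
      exact hQ.2
  have hgrad : ContinuousOn E.grad ({A : Mat m | A.IsHermitian} ∩ Metric.closedBall P ρ) :=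
    E.grad_continuousOn.mono hsub
  have hcont : ContinuousOn (fun Q => ip (E.grad Q) (Q - P))
      ({A : Mat m | A.IsHermitian} ∩ Metric.closedBall P ρ) :=
    continuousOn_ip hgrad (continuous_id.sub continuous_const).continuousOn
  obtain ⟨C, hC⟩ := (isCompact_isHermitian_inter_closedBall P ρ).bddAbove_image hcont
  refine ⟨ρ, hρ, E.f P + C, fun Q hQ hQP => ?_⟩
  have hQPD := hball Q hQ hQP
  refine ⟨E.posDef_mem_dom Q hQPD, ?_⟩
  have h1 := ip_grad_le hQPD (E.posDef_mem_dom P hP)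
  have hQball : Q ∈ Metric.closedBall P ρ := by rwa [Metric.mem_closedBall, dist_eq_norm]
  have h2 : ip (E.grad Q) (Q - P) ≤ C :=
    hC (Set.mem_image_of_mem (fun Q => ip (E.grad Q) (Q - P)) ⟨hQ, hQball⟩)
  simp only [ip_sub_right] at h1 h2
  linarith

lemma posDef_segment {A P : Mat m} (hA : A.PosSemidef) (hP : P.PosDef) {s : ℝ} (h0 : 0 < s)
    (h1 : s ≤ 1) : (A + s • (P - A)).PosDef := by
  have e : A + s • (P - A) = (1 - s) • A + s • P := by module
  rw [e]
  exact PosDef.posSemidef_add (hA.smul (sub_nonneg.mpr h1)) (hP.smul h0)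

/-- Essential smoothness forces a tilted minimizer along a segment into the positive definite
cone to be positive definite itself. -/
lemma posDef_of_min_segment (hess : EssSmooth E) {A P L : Mat m} (hA : E.F A ≠ ⊤)
    (hP : P.PosDef)
    (hmin : ∀ s : ℝ, 0 < s → s ≤ 1 →
      E.f A - ip L A ≤ E.f (A + s • (P - A)) - ip L (A + s • (P - A))) :
    A.PosDef := by
  by_contra hcon
  have hApsd := E.dom_subset_psd A hA
  obtain ⟨ρ, hρ, M, hM⟩ := exists_f_le_on_ball (E := E) hP
  have hbound : ∀ s : ℝ, 0 < s → s ≤ 1 →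
      fnorm (E.grad (A + s • (P - A))) ≤ (M - E.f A - ip L (P - A)) / ρ := by
    intro s h0 h1
    have hB := posDef_segment hApsd hP h0 h1
    set B := A + s • (P - A) with hBdef
    set g := E.grad B
    have hg : g.IsHermitian := E.grad_isHermitian B hB
    set W := (fnorm g)⁻¹ • g
    have hn : 0 ≤ fnorm g := Real.sqrt_nonneg _
    have hW : ‖W‖ ≤ 1 := by
      rw [norm_smul, norm_inv, Real.norm_eq_abs, abs_of_nonneg hn]
      exact inv_mul_le_one_of_le₀ (norm_le_fnorm g) hn
    have hgW : ip g W = fnorm g := by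
      rw [ip_smul_right, ip_self_eq_fnorm_sq hg]
      rcases eq_or_ne (fnorm g) 0 with h | h
      · simp [h]
      · field_simp
    have hQ := hM (P + ρ • W) (hP.isHermitian.add (isHermitian_smul (isHermitian_smul hg _) ρ))
      (by
        rw [add_sub_cancel_left, norm_smul, Real.norm_eq_abs, abs_of_pos hρ]
        exact mul_le_of_le_one_right hρ.le hW)
    have i1 := ip_grad_le hB hQ.1
    have i2 := ip_grad_le hB hA
    have i3 := hmin s h0 h1
    have eA : A - B = (-s) • (P - A) := by rw [hBdef]; module
    have eQ : P + ρ • W - B = (1 - s) • (P - A) + ρ • W := by rw [hBdef]; module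
    rw [eQ, ip_add_right, ip_smul_right, ip_smul_right, hgW] at i1
    rw [eA, ip_smul_right] at i2
    rw [← hBdef, hBdef, ip_add_right, ip_smul_right, ← hBdef] at i3
    have i4 : s * ip L (P - A) ≤ s * ip g (P - A) := by linarith
    have i5 : ip L (P - A) ≤ ip g (P - A) := le_of_mul_le_mul_left i4 h0
    have i6 : (1 - s) * ip L (P - A) ≤ (1 - s) * ip g (P - A) :=
      mul_le_mul_of_nonneg_left i5 (sub_nonneg.mpr h1)
    rw [le_div_iff₀ hρ]
    linarith [hQ.2]
  have hs0 : ∀ k : ℕ, 0 < 1 / ((k : ℝ) + 1) := fun k => by positivity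
  have hs1 : ∀ k : ℕ, 1 / ((k : ℝ) + 1) ≤ 1 := fun k => by
    rw [div_le_one (by positivity)]
    linarith [Nat.cast_nonneg (α := ℝ) k]
  have hlim : Tendsto (fun k : ℕ => A + (1 / ((k : ℝ) + 1)) • (P - A)) atTop (𝓝 A) := by
    simpa using (tendsto_one_div_add_atTop_nhds_zero_nat (𝕜 := ℝ)).smul_const (P - A)
      |>.const_add A
  have htop := hess _ A (fun k => posDef_segment hApsd hP (hs0 k) (hs1 k)) hlim hApsd hcon
  obtain ⟨k, hk⟩ := (htop.eventually_gt_atTop ((M - E.f A - ip L (P - A)) / ρ)).exists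
  exact hk.not_ge (hbound _ (hs0 k) (hs1 k))

/-- Every positive definite `P` can be moved orthogonally to `V` to a positive definite matrix
whose gradient lies in an affine space with direction `V` that meets the gradient image. -/
lemma exists_posDef_grad_mem (hess : EssSmooth E) {V : Submodule ℝ (Mat m)}
    (hV : ∀ A ∈ V, A.IsHermitian) {P Q : Mat m} (hP : P.PosDef) (hQ : Q.PosDef) :
    ∃ A : Mat m, A.PosDef ∧ E.grad A - E.grad Q ∈ V ∧ ∀ U ∈ V, ip (A - P) U = 0 := by
  have hclosed : IsClosed {A : Mat m | ∀ U ∈ V, ip (A - P) U = 0} := by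
    simp only [Set.ofPred_forall]
    refine isClosed_biInter fun U _ => isClosed_eq ?_ continuous_const
    exact continuous_ip.comp ((continuous_id.sub continuous_const).prodMk continuous_const)
  obtain ⟨A, hAV, hFA, hmin⟩ := exists_min_tilted_of_isClosed (E := E) hclosed hQ
    (show P ∈ {A : Mat m | ∀ U ∈ V, ip (A - P) U = 0} by intro U _; simp [ip])
    (E.posDef_mem_dom P hP)
  have hAPD : A.PosDef := by
    refine posDef_of_min_segment hess hFA hP (L := E.grad Q) fun s h0 h1 => ?_
    refine hmin _ (fun U hU => ?_) (E.posDef_mem_dom _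
      (posDef_segment (E.dom_subset_psd A hFA) hP h0 h1))
    have e : A + s • (P - A) - P = (1 - s) • (A - P) := by module
    rw [e, ip_smul_left, hAV U hU, mul_zero]
  refine ⟨A, hAPD, mem_of_forall_ip_perp hV
    ((E.grad_isHermitian A hAPD).sub (E.grad_isHermitian Q hQ)) fun W hW => ?_, hAV⟩
  refine ip_grad_sub_eq_zero hAPD hW.1 ?_
  obtain ⟨r, hr, hball⟩ := exists_closedBall_posDef hAPD
  filter_upwards [eventually_norm_add_smul_sub_lt (A := A) (P := A) W (by simpa using hr)]
    with s hs
  refine hmin _ (fun U hU => ?_) (E.posDef_mem_dom _ (hball _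
    (hAPD.isHermitian.add (isHermitian_smul hW.1 s)) hs.le))
  have e : A + s • W - P = (A - P) + s • W := by abel
  rw [e, ip_add_left, ip_smul_left, hAV U hU, hW.2 U hU, mul_zero, add_zero]

end EClass

end Auxiliary

/-- Theorem `th:optexist`. Suppose `F ∈ 𝓔^m` is essentially smooth, let
`𝓛 = A₀ + V ⊆ S^m` be an affine subspace (with `𝓛 ∩ 𝕃^m_+ ≠ ∅`, the standing
Assumption 1) and `S_n ∈ S^m`. Then the maximum of `g_n(L) = −F*(L) + ⟨L,S_n⟩` over
`𝓛 ∩ 𝕃^m_+` is attained iff the orthogonal projection `(S_n)_𝓛` of `S_n` onto `𝓛`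
belongs to `(S^m_+)_𝓛`, the image of `S^m_+` under orthogonal projection onto `𝓛`. -/
theorem bregman_estimator_exists_iff {m : ℕ} (E : EClass m) (hess : EssSmooth E)
    (V : Submodule ℝ (Mat m)) (hV : ∀ A ∈ V, Matrix.IsHermitian A)
    (A0 : Mat m) (hA0 : A0.IsHermitian)
    (hassum : (affSet A0 V ∩ Lplus E).Nonempty)
    (Sn : Mat m) (hSn : Sn.IsHermitian) :
    (∃ Lhat ∈ affSet A0 V ∩ Lplus E, IsMaxOn (gn E Sn) (affSet A0 V ∩ Lplus E) Lhat) ↔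
      ∃ X : Mat m, IsProjOn A0 V Sn X ∧ ∃ P : Mat m, P.PosDef ∧ IsProjOn A0 V P X := by
  constructor
  · rintro ⟨_, ⟨hPV, P, hP, rfl⟩, hmax⟩
    obtain ⟨X, hX⟩ := exists_isProjOn hV A0 Sn
    refine ⟨X, hX, P, hP, hX.1, fun U hU => ?_⟩
    have h := EClass.ip_sub_eq_zero_of_isMaxOn hV hP hPV hmax U hU
    have hX' := hX.2 U hU
    simp only [ip_sub_left] at h hX' ⊢
    linarith
  · rintro ⟨X, hX, P, hP, hPX⟩
    obtain ⟨_, hQV, Q, hQ, rfl⟩ := hassum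
    obtain ⟨A, hA, hgrad, hAP⟩ := EClass.exists_posDef_grad_mem hess hV hP hQ
    have hAV : E.grad A ∈ affSet A0 V := by
      have e : E.grad A - A0 = (E.grad A - E.grad Q) + (E.grad Q - A0) := by abel
      rw [affSet, Set.mem_ofPred_eq, e]
      exact V.add_mem hgrad hQV
    refine ⟨E.grad A, ⟨hAV, A, hA, rfl⟩, EClass.isMaxOn_gn hA hAV fun U hU => ?_⟩
    have h1 := hX.2 U hU
    have h2 := hPX.2 U hU
    have h3 := hAP U hU
    simp only [ip_sub_left] at h1 h2 h3 ⊢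
    linarith

end Entropic
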